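/- arXiv:2003.09397 — 3 statements merged into one kernel-verified Lean document; each statement's English description precedes it below -/
import Mathlib

section
/- For every integer N ≥ 1, the function 𝒯(p₀) = T₊(p₀, (1/(2N))√A(p₀)) satisfies 𝒯(p₀) → 0 as p₀ → 1⁻ and 𝒯(p₀) → ∞ as p₀ → 0⁺; consequently (being continuous and strictly decreasing) 𝒯 is a bijection from (0,1) onto (0,∞). -/
open Real MeasureTheory Set Filter Topology

/-- The potential `A(u) = u²(1 − u²)`. -/
noncomputable def A (u : ℝ) : ℝ := u ^ 2 * (1 - u ^ 2)

/-- `p⋆ = 1/√2`, the unique positive critical point of `A`, with `A p⋆ = 1/4`. -/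
noncomputable def pstar : ℝ := 1 / Real.sqrt 2

/-- For energy `E > −1/4`, the unique root `p₊ > p⋆` of `A(p₊) = −E` (explicit formula). -/
noncomputable def pPlus (E : ℝ) : ℝ := Real.sqrt ((1 + Real.sqrt (1 + 4 * E)) / 2)

/-- For energy `E ∈ (−1/4, 0)`, the unique root `p₋ ∈ (0, p⋆)` of `A(p₋) = −E` (explicit formula). -/
noncomputable def pMinus (E : ℝ) : ℝ := Real.sqrt ((1 - Real.sqrt (1 + 4 * E)) / 2)

/-- The period function `T₊(p₀,q₀) = ∫_{p₀}^{p₊} du/√(E + A(u))`, `E = q₀² − A(p₀)`. -/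
noncomputable def Tplus (p₀ q₀ : ℝ) : ℝ :=
  ∫ u in p₀..pPlus (q₀ ^ 2 - A p₀), 1 / Real.sqrt ((q₀ ^ 2 - A p₀) + A u)

/-- The period function `T₋(p₀,q₀) = ∫_{p₋}^{p₀} du/√(E + A(u))`, `E = q₀² − A(p₀)`. -/
noncomputable def Tminus (p₀ q₀ : ℝ) : ℝ :=
  ∫ u in pMinus (q₀ ^ 2 - A p₀)..p₀, 1 / Real.sqrt ((q₀ ^ 2 - A p₀) + A u)

/-- `𝒯(p₀) = T₊(p₀, (1/(2N))√A(p₀))`. -/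
noncomputable def calT (N : ℕ) (p₀ : ℝ) : ℝ :=
  Tplus p₀ (1 / (2 * (N : ℝ)) * Real.sqrt (A p₀))

/-- The integrand of the period function in the angular variable. -/
noncomputable def kern (x : ℝ) : ℝ := (√(1 + x))⁻¹

lemma kern_sub_le {x y : ℝ} (hx : 0 ≤ x) (hxy : x ≤ y) : kern x - kern y ≤ (y - x) / 2 := by
  have h1 : 1 ≤ √(1 + x) := Real.one_le_sqrt.2 (by linarith)
  have h2 : 1 ≤ √(1 + y) := Real.one_le_sqrt.2 (by linarith)
  have e1 : √(1 + x) ^ 2 = 1 + x := Real.sq_sqrt (by linarith)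
  have e2 : √(1 + y) ^ 2 = 1 + y := Real.sq_sqrt (by linarith)
  have h3 : √(1 + x) ≤ √(1 + y) := Real.sqrt_le_sqrt (by linarith)
  unfold kern
  set a := √(1 + x)
  set b := √(1 + y)
  have hab : 1 ≤ a * b := by nlinarith
  rw [show y - x = b ^ 2 - a ^ 2 by linarith, inv_sub_inv (by positivity) (by positivity),
    div_le_iff₀ (by positivity)]
  have : 2 ≤ (b + a) * (a * b) := by nlinarith
  nlinarith

lemma le_kern_sub {x y : ℝ} (hx : -1 < x) (hxy : x ≤ y) (hy : y ≤ 0) :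
    (y - x) / 2 ≤ kern x - kern y := by
  have h1 : √(1 + x) ≤ 1 := Real.sqrt_le_one.2 (by linarith)
  have h2 : √(1 + y) ≤ 1 := Real.sqrt_le_one.2 (by linarith)
  have e1 : √(1 + x) ^ 2 = 1 + x := Real.sq_sqrt (by linarith)
  have e2 : √(1 + y) ^ 2 = 1 + y := Real.sq_sqrt (by linarith)
  have p1 : 0 < √(1 + x) := Real.sqrt_pos.2 (by linarith)
  have h3 : √(1 + x) ≤ √(1 + y) := Real.sqrt_le_sqrt (by linarith)
  unfold kern
  set a := √(1 + x)
  set b := √(1 + y)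
  have p2 : 0 < b := by linarith
  have hab : a * b ≤ 1 := by nlinarith
  have hab0 : 0 < a * b := by positivity
  rw [show y - x = b ^ 2 - a ^ 2 by linarith, inv_sub_inv (by positivity) (by positivity),
    le_div_iff₀ (by positivity)]
  have : (b + a) * (a * b) ≤ 2 := by nlinarith
  nlinarith

lemma kern_pos {x : ℝ} (hx : -1 < x) : 0 < kern x :=
  inv_pos.2 (Real.sqrt_pos.2 (by linarith))

lemma kern_anti {x y : ℝ} (hx : -1 < x) (hxy : x ≤ y) : kern y ≤ kern x := by
  unfold kern
  have : 0 < √(1 + x) := Real.sqrt_pos.2 (by linarith)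
  gcongr

lemma kern_zero : kern 0 = 1 := by simp [kern]

/-- The even part of `kern` is monotone in the modulus. -/
lemma kern_add_kern_neg_le {a b : ℝ} (ha : 0 ≤ a) (hab : a ≤ b) (hb : b < 1) :
    kern a + kern (-a) ≤ kern b + kern (-b) := by
  have h1 := kern_sub_le ha hab
  have h2 := le_kern_sub (x := -b) (y := -a) (by linarith) (by linarith) (by linarith)
  linarith

lemma neg_one_lt_mul_cos {D : ℝ} (h0 : 0 ≤ D) (h1 : D < 1) (t : ℝ) : -1 < D * cos t := by
  nlinarith [Real.neg_one_le_cos t]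

lemma continuous_kern_mul_cos {D : ℝ} (h0 : 0 ≤ D) (h1 : D < 1) :
    Continuous fun t => kern (D * cos t) := by
  unfold kern
  refine Continuous.inv₀ (by fun_prop) fun t => ?_
  have := neg_one_lt_mul_cos h0 h1 t
  exact (Real.sqrt_pos.2 (by linarith)).ne'

lemma intervalIntegrable_kern_mul_cos {D : ℝ} (h0 : 0 ≤ D) (h1 : D < 1) (a b : ℝ) :
    IntervalIntegrable (fun t => kern (D * cos t)) volume a b :=
  (continuous_kern_mul_cos h0 h1).intervalIntegrable a b

/-- The substitution `u² = (1 + D cos t) / 2` in the period integral. -/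
lemma integral_inv_sqrt_add_A {D θ : ℝ} (h0 : 0 < D) (h1 : D < 1) (hθ : θ ∈ Ioo 0 π) :
    ∫ u in √((1 + D * cos θ) / 2)..√((1 + D) / 2), 1 / √((D ^ 2 - 1) / 4 + A u) =
      (√2)⁻¹ * ∫ t in 0..θ, kern (D * cos t) := by
  set f : ℝ → ℝ := fun t => √((1 + D * cos t) / 2) with hf
  have hpos : ∀ t, 0 < (1 + D * cos t) / 2 := fun t => by
    linarith [neg_one_lt_mul_cos h0.le h1 t]
  have hanti : StrictAntiOn f (Icc 0 π) := fun x hx y hy hxy => by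
    have := Real.strictAntiOn_cos hx hy hxy
    have := mul_lt_mul_of_pos_left this h0
    exact Real.sqrt_lt_sqrt (hpos y).le (by linarith)
  have hcont : Continuous f := by fun_prop
  have hsub : Icc 0 θ ⊆ Icc 0 π := Icc_subset_Icc_right hθ.2.le
  have hf0 : f 0 = √((1 + D) / 2) := by simp [hf]
  have himg : f '' Ioo 0 θ = Ioo (f θ) (f 0) := by
    apply Subset.antisymm
    · rintro _ ⟨t, ht, rfl⟩
      exact ⟨hanti (hsub ⟨ht.1.le, ht.2.le⟩) (hsub ⟨hθ.1.le, le_rfl⟩) ht.2,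
        hanti (hsub ⟨le_rfl, hθ.1.le⟩) (hsub ⟨ht.1.le, ht.2.le⟩) ht.1⟩
    · exact intermediate_value_Ioo' hθ.1.le hcont.continuousOn
  have hle : f θ ≤ f 0 :=
    hanti.antitoneOn (hsub ⟨le_rfl, hθ.1.le⟩) (hsub ⟨hθ.1.le, le_rfl⟩) hθ.1.le
  rw [← hf0, show √((1 + D * cos θ) / 2) = f θ from rfl, intervalIntegral.integral_of_le hle,
    intervalIntegral.integral_of_le hθ.1.le, integral_Ioc_eq_integral_Ioo,
    integral_Ioc_eq_integral_Ioo, ← himg,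
    integral_image_eq_integral_abs_deriv_smul (f := f)
      (f' := fun t => (D * -sin t / 2) / (2 * √((1 + D * cos t) / 2))) measurableSet_Ioo ?_
      (hanti.injOn.mono (Ioo_subset_Icc_self.trans hsub)), ← integral_const_mul]
  · refine setIntegral_congr_fun measurableSet_Ioo fun t ht => ?_
    have hs : 0 < sin t := Real.sin_pos_of_pos_of_lt_pi ht.1 (ht.2.trans hθ.2)
    have hsq : f t ^ 2 = (1 + D * cos t) / 2 := Real.sq_sqrt (hpos t).le
    have hA : (D ^ 2 - 1) / 4 + A (f t) = (D * sin t / 2) ^ 2 := by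
      unfold A
      rw [hsq]
      nlinarith [Real.sin_sq_add_cos_sq t]
    have hft : 0 < √((1 + D * cos t) / 2) := Real.sqrt_pos.2 (hpos t)
    have hk : kern (D * cos t) = (√2 * √((1 + D * cos t) / 2))⁻¹ := by
      rw [kern, ← Real.sqrt_mul (by norm_num)]
      congr 2
      ring
    have h2 : √2 * √2 = 2 := Real.mul_self_sqrt (by norm_num)
    simp only [smul_eq_mul]
    rw [hA, Real.sqrt_sq (by positivity), hk,
      show D * -sin t / 2 / (2 * √((1 + D * cos t) / 2)) =
        -(D * sin t / 2 / (2 * √((1 + D * cos t) / 2))) by ring,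
      abs_neg, abs_of_pos (by positivity)]
    rw [← mul_inv, ← mul_assoc, h2]
    field_simp
  · intro t _
    have h := (((Real.hasDerivAt_cos t).const_mul D).const_add 1).div_const 2
    exact (h.sqrt (hpos t).ne').hasDerivWithinAt

/-- The modulus `D` as a function of the limiting angle `θ`. -/
noncomputable def amp (c θ : ℝ) : ℝ := c / √(c ^ 2 + (1 - c ^ 2) * sin θ ^ 2)

/-- The period (up to the factor `√2`) as a function of the limiting angle `θ`. -/
noncomputable def anglePeriod (c θ : ℝ) : ℝ := ∫ t in 0..θ, kern (amp c θ * cos t)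

lemma amp_denom_pos {c : ℝ} (h0 : 0 < c) (h1 : c < 1) (θ : ℝ) :
    0 < c ^ 2 + (1 - c ^ 2) * sin θ ^ 2 := by
  have : 0 < 1 - c ^ 2 := by nlinarith
  positivity

lemma amp_pos {c : ℝ} (h0 : 0 < c) (h1 : c < 1) (θ : ℝ) : 0 < amp c θ :=
  div_pos h0 (Real.sqrt_pos.2 (amp_denom_pos h0 h1 θ))

lemma amp_lt_one {c θ : ℝ} (h0 : 0 < c) (h1 : c < 1) (hθ : θ ∈ Ioo 0 π) : amp c θ < 1 := by
  have hs : 0 < sin θ := Real.sin_pos_of_mem_Ioo hθ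
  have : 0 < 1 - c ^ 2 := by nlinarith
  rw [amp, div_lt_one (Real.sqrt_pos.2 (amp_denom_pos h0 h1 θ))]
  apply Real.lt_sqrt_of_sq_lt
  nlinarith [mul_pos this (pow_pos hs 2)]

lemma amp_le_amp {c x y : ℝ} (h0 : 0 < c) (h1 : c < 1) (hy : 0 ≤ sin y) (hxy : sin y ≤ sin x) :
    amp c x ≤ amp c y := by
  have : 0 < 1 - c ^ 2 := by nlinarith
  have := Real.sqrt_pos.2 (amp_denom_pos h0 h1 y)
  unfold amp
  gcongr

lemma sin_mul_amp_sub_lt {c x y : ℝ} (h0 : 0 < c) (h1 : c < 1) (hy : 0 < sin y)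
    (hxy : sin y < sin x) :
    sin x * (amp c y - amp c x) < 2 * (sin x - sin y) := by
  have hk : 0 < 1 - c ^ 2 := by nlinarith
  have px := Real.sqrt_pos.2 (amp_denom_pos h0 h1 x)
  have py := Real.sqrt_pos.2 (amp_denom_pos h0 h1 y)
  have ex := Real.sq_sqrt (amp_denom_pos h0 h1 x).le
  have ey := Real.sq_sqrt (amp_denom_pos h0 h1 y).le
  have hle : √(c ^ 2 + (1 - c ^ 2) * sin y ^ 2) ≤ √(c ^ 2 + (1 - c ^ 2) * sin x ^ 2) := by
    gcongr
  have hcy : c ≤ √(c ^ 2 + (1 - c ^ 2) * sin y ^ 2) :=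
    Real.le_sqrt_of_sq_le (by nlinarith [mul_pos hk (pow_pos hy 2)])
  unfold amp
  set a := √(c ^ 2 + (1 - c ^ 2) * sin x ^ 2)
  set b := √(c ^ 2 + (1 - c ^ 2) * sin y ^ 2)
  set s := sin x
  set r := sin y
  have hs : 0 < s := hy.trans hxy
  have step : c / b - c / a ≤ (a ^ 2 - b ^ 2) / a ^ 2 := by
    rw [div_sub_div _ _ py.ne' px.ne', div_le_div_iff₀ (by positivity) (by positivity)]
    have : c * (a - b) * a ≤ b * (a - b) * (a + b) := by
      have := sub_nonneg.2 hle
      gcongr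
      linarith
    nlinarith
  calc s * (c / b - c / a) ≤ s * ((a ^ 2 - b ^ 2) / a ^ 2) := by gcongr
    _ < 2 * (s - r) := by
      rw [← mul_div_assoc, div_lt_iff₀ (by positivity), ex, ey]
      have hd : 0 < s - r := sub_pos.2 hxy
      have e1 : s * (s + r) * (1 - c ^ 2) ≤ 2 * ((1 - c ^ 2) * s ^ 2) := by
        have : s * (s + r) ≤ 2 * s ^ 2 := by nlinarith
        nlinarith
      have e2 : s * (s + r) * (1 - c ^ 2) < 2 * (c ^ 2 + (1 - c ^ 2) * s ^ 2) := by
        nlinarith [pow_pos h0 2]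
      nlinarith [mul_lt_mul_of_pos_right e2 hd]

lemma anglePeriod_strictMonoOn_left {c : ℝ} (h0 : 0 < c) (h1 : c < 1) :
    StrictMonoOn (anglePeriod c) (Ioc 0 (π / 2)) := by
  intro x hx y hy hxy
  have hπ := Real.pi_pos
  have lx := amp_lt_one h0 h1 (θ := x) ⟨hx.1, by linarith [hx.2]⟩
  have ly := amp_lt_one h0 h1 (θ := y) ⟨hy.1, by linarith [hy.2]⟩
  have px := amp_pos h0 h1 x
  have py := amp_pos h0 h1 y
  have hamp : amp c y ≤ amp c x := by
    apply amp_le_amp h0 h1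
    · exact Real.sin_nonneg_of_nonneg_of_le_pi hx.1.le (by linarith [hx.2])
    · exact Real.sin_le_sin_of_le_of_le_pi_div_two (by linarith [hx.1]) hy.2 hxy.le
  unfold anglePeriod
  rw [← intervalIntegral.integral_add_adjacent_intervals
    (intervalIntegrable_kern_mul_cos py.le ly 0 x) (intervalIntegrable_kern_mul_cos py.le ly x y)]
  have hpos : 0 < ∫ t in x..y, kern (amp c y * cos t) :=
    intervalIntegral.intervalIntegral_pos_of_pos (intervalIntegrable_kern_mul_cos py.le ly x y)
      (fun t => kern_pos (neg_one_lt_mul_cos py.le ly t)) hxy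
  have hle : ∫ t in 0..x, kern (amp c x * cos t) ≤ ∫ t in 0..x, kern (amp c y * cos t) := by
    apply intervalIntegral.integral_mono_on hx.1.le (intervalIntegrable_kern_mul_cos px.le lx 0 x)
      (intervalIntegrable_kern_mul_cos py.le ly 0 x)
    intro t ht
    have hc : 0 ≤ cos t := Real.cos_nonneg_of_mem_Icc ⟨by linarith [ht.1], by linarith [ht.2, hx.2]⟩
    exact kern_anti (neg_one_lt_mul_cos py.le ly t) (by gcongr)
  linarith

/-- On an interval symmetric about `π / 2`, the angular integral is monotone in the modulus. -/
lemma integral_kern_mul_cos_mono {D D' x : ℝ} (h0 : 0 ≤ D) (hD : D ≤ D') (h1 : D' < 1)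
    (hx : π / 2 ≤ x) :
    ∫ t in (π - x)..x, kern (D * cos t) ≤ ∫ t in (π - x)..x, kern (D' * cos t) := by
  have key : ∀ d, 0 ≤ d → d < 1 → 2 * ∫ t in (π - x)..x, kern (d * cos t) =
      ∫ t in (π - x)..x, (kern (d * cos t) + kern (-(d * cos t))) := by
    intro d hd0 hd1
    have h := intervalIntegral.integral_comp_sub_left (a := π - x) (b := x)
      (fun t => kern (d * cos t)) π
    simp only [Real.cos_pi_sub, sub_sub_cancel, mul_neg] at h
    rw [intervalIntegral.integral_add (intervalIntegrable_kern_mul_cos hd0 hd1 _ _) ?_, h, two_mul]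
    have := ((continuous_kern_mul_cos hd0 hd1).comp (continuous_sub_left π)).intervalIntegrable
      (μ := volume) (π - x) x
    simpa [Function.comp_def, Real.cos_pi_sub] using this
  have hsum : ∀ d, 0 ≤ d → d < 1 → IntervalIntegrable
      (fun t => kern (d * cos t) + kern (-(d * cos t))) volume (π - x) x := by
    intro d hd0 hd1
    have := ((continuous_kern_mul_cos hd0 hd1).comp (continuous_sub_left π)).intervalIntegrable
      (μ := volume) (π - x) x
    refine (intervalIntegrable_kern_mul_cos hd0 hd1 _ _).add ?_
    simpa [Function.comp_def, Real.cos_pi_sub] using this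
  have hD0 := h0.trans hD
  have hD1 := hD.trans_lt h1
  suffices h : 2 * ∫ t in (π - x)..x, kern (D * cos t) ≤ 2 * ∫ t in (π - x)..x, kern (D' * cos t) by
    linarith
  rw [key D h0 hD1, key D' hD0 h1]
  refine intervalIntegral.integral_mono_on (by linarith) (hsum D h0 hD1) (hsum D' hD0 h1) ?_
  intro t _
  have hlt := neg_one_lt_mul_cos hD0 h1 t
  have hle := Real.cos_le_one t
  rcases le_total 0 (cos t) with hc | hc
  · exact kern_add_kern_neg_le (by positivity) (by gcongr) (by nlinarith)
  · have := kern_add_kern_neg_le (a := -(D * cos t)) (b := -(D' * cos t)) (by nlinarith)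
      (by nlinarith) (by linarith)
    simp only [neg_neg] at this
    linarith

lemma anglePeriod_strictMonoOn_right {c : ℝ} (h0 : 0 < c) (h1 : c < 1) :
    StrictMonoOn (anglePeriod c) (Ico (π / 2) π) := by
  intro x hx y hy hxy
  have hπ := Real.pi_pos
  have hx0 : 0 < x := by linarith [hx.1]
  have hy0 : 0 < y := by linarith
  have lx := amp_lt_one h0 h1 (θ := x) ⟨hx0, hx.2⟩
  have ly := amp_lt_one h0 h1 (θ := y) ⟨hy0, hy.2⟩
  have px := amp_pos h0 h1 x
  have py := amp_pos h0 h1 y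
  have hsy : 0 < sin y := Real.sin_pos_of_pos_of_lt_pi hy0 hy.2
  have hsin : sin y < sin x := by
    rw [← Real.sin_pi_sub y, ← Real.sin_pi_sub x]
    exact Real.sin_lt_sin_of_lt_of_le_pi_div_two (by linarith [hy.2]) (by linarith [hx.1])
      (by linarith)
  have hamp : amp c x ≤ amp c y := amp_le_amp h0 h1 hsy.le hsin.le
  have hdiff : sin x - sin y ≤ y - x := by
    have := Real.abs_sin_sub_sin_le x y
    rw [abs_sub_comm x y, abs_of_pos (sub_pos.2 hxy)] at this
    exact (le_abs_self _).trans this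
  have hkey := sin_mul_amp_sub_lt h0 h1 hsy hsin
  unfold anglePeriod
  set d := amp c x
  set e := amp c y
  have id := intervalIntegrable_kern_mul_cos px.le lx
  have ie := intervalIntegrable_kern_mul_cos py.le ly
  rw [← intervalIntegral.integral_add_adjacent_intervals (ie 0 x) (ie x y),
    ← intervalIntegral.integral_add_adjacent_intervals (ie 0 (π - x)) (ie (π - x) x),
    ← intervalIntegral.integral_add_adjacent_intervals (id 0 (π - x)) (id (π - x) x)]
  have hmid := integral_kern_mul_cos_mono px.le hamp ly hx.1
  have hlast : y - x ≤ ∫ t in x..y, kern (e * cos t) := by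
    have : ∫ t in x..y, (1 : ℝ) ≤ ∫ t in x..y, kern (e * cos t) := by
      refine intervalIntegral.integral_mono_on hxy.le (by simp) (ie x y) fun t ht => ?_
      have hc : cos t ≤ 0 := Real.cos_nonpos_of_pi_div_two_le_of_le (by linarith [hx.1, ht.1])
        (by linarith [ht.2, hy.2])
      rw [← kern_zero]
      exact kern_anti (neg_one_lt_mul_cos py.le ly t) (by nlinarith)
    simpa using this
  have hfirst : (∫ t in 0..(π - x), kern (d * cos t)) - ∫ t in 0..(π - x), kern (e * cos t) ≤
      (e - d) / 2 * sin x := by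
    rw [← intervalIntegral.integral_sub (id _ _) (ie _ _)]
    have : ∫ t in 0..(π - x), (kern (d * cos t) - kern (e * cos t)) ≤
        ∫ t in 0..(π - x), (e - d) / 2 * cos t := by
      refine intervalIntegral.integral_mono_on (by linarith [hx.2]) ((id _ _).sub (ie _ _))
        (Continuous.intervalIntegrable (by fun_prop) _ _) fun t ht => ?_
      have hc : 0 ≤ cos t :=
        Real.cos_nonneg_of_mem_Icc ⟨by linarith [ht.1], by linarith [ht.2, hx.1]⟩
      have := kern_sub_le (x := d * cos t) (y := e * cos t) (by positivity) (by gcongr)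
      linarith
    simpa using this
  linarith

lemma anglePeriod_strictMonoOn {c : ℝ} (h0 : 0 < c) (h1 : c < 1) :
    StrictMonoOn (anglePeriod c) (Ioo 0 π) := by
  have hπ := Real.pi_pos
  have := (anglePeriod_strictMonoOn_left h0 h1).union (anglePeriod_strictMonoOn_right h0 h1)
    (isGreatest_Ioc (by linarith)) (isLeast_Ico (by linarith))
  rwa [Ioc_union_Ico_eq_Ioo (by linarith) (by linarith)] at this

lemma anglePeriod_pos {c θ : ℝ} (h0 : 0 < c) (h1 : c < 1) (hθ : θ ∈ Ioo 0 π) :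
    0 < anglePeriod c θ :=
  have hp := (amp_pos h0 h1 θ).le
  have hl := amp_lt_one h0 h1 hθ
  intervalIntegral.intervalIntegral_pos_of_pos (intervalIntegrable_kern_mul_cos hp hl _ _)
    (fun t => kern_pos (neg_one_lt_mul_cos hp hl t)) hθ.1

lemma continuousOn_anglePeriod {c : ℝ} (h0 : 0 < c) (h1 : c < 1) :
    ContinuousOn (anglePeriod c) (Ioo 0 π) := by
  rw [continuousOn_iff_continuous_domRestrict]
  have hamp : Continuous (amp c) :=
    continuous_const.div (by fun_prop) fun θ => (Real.sqrt_pos.2 (amp_denom_pos h0 h1 θ)).ne'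
  refine intervalIntegral.continuous_parametric_intervalIntegral_of_continuous
    (f := fun (θ : Ioo (0 : ℝ) π) t => kern (amp c θ * cos t)) ?_ continuous_subtype_val
  unfold kern Function.uncurry
  refine Continuous.inv₀ (by fun_prop) fun q => ?_
  have := neg_one_lt_mul_cos (amp_pos h0 h1 q.1).le (amp_lt_one h0 h1 q.1.2) q.2
  exact (Real.sqrt_pos.2 (by linarith)).ne'

lemma tendsto_anglePeriod_zero {c : ℝ} (h0 : 0 < c) (h1 : c < 1) :
    Tendsto (anglePeriod c) (𝓝[>] 0) (𝓝 0) := by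
  have hπ := Real.pi_pos
  have hmem : ∀ᶠ θ in 𝓝[>] (0 : ℝ), θ ∈ Ioo 0 (π / 2) := Ioo_mem_nhdsGT (by linarith)
  refine tendsto_of_tendsto_of_tendsto_of_le_of_le' tendsto_const_nhds
    (tendsto_id.mono_left nhdsWithin_le_nhds) ?_ ?_
  · filter_upwards [hmem] with θ hθ
    exact (anglePeriod_pos h0 h1 ⟨hθ.1, by linarith [hθ.2]⟩).le
  · filter_upwards [hmem] with θ hθ
    have hp := (amp_pos h0 h1 θ).le
    have hl := amp_lt_one h0 h1 (θ := θ) ⟨hθ.1, by linarith [hθ.2]⟩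
    have : ∫ t in 0..θ, kern (amp c θ * cos t) ≤ ∫ t in 0..θ, (1 : ℝ) := by
      refine intervalIntegral.integral_mono_on hθ.1.le (intervalIntegrable_kern_mul_cos hp hl _ _)
        (by simp) fun t ht => ?_
      have hc : 0 ≤ cos t :=
        Real.cos_nonneg_of_mem_Icc ⟨by linarith [ht.1], by linarith [ht.2, hθ.2]⟩
      rw [← kern_zero]
      exact kern_anti (by norm_num) (by positivity)
    simpa [anglePeriod] using this

lemma one_sub_amp_le {c θ : ℝ} (h0 : 0 < c) (h1 : c < 1) (hθ : θ ∈ Ioo 0 π) :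
    1 - amp c θ ≤ (π - θ) ^ 2 / c ^ 2 := by
  have hp := amp_pos h0 h1 θ
  have hl := amp_lt_one h0 h1 hθ
  have hs : 0 < sin θ := Real.sin_pos_of_mem_Ioo hθ
  have hs' : sin θ ≤ π - θ := by
    rw [← Real.sin_pi_sub]
    exact Real.sin_le (by linarith [hθ.2])
  have hd := amp_denom_pos h0 h1 θ
  have hsq : amp c θ ^ 2 = c ^ 2 / (c ^ 2 + (1 - c ^ 2) * sin θ ^ 2) := by
    rw [amp, div_pow, Real.sq_sqrt hd.le]
  calc 1 - amp c θ ≤ 1 - amp c θ ^ 2 := by nlinarith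
    _ ≤ sin θ ^ 2 / c ^ 2 := by
      rw [hsq, one_sub_div hd.ne', div_le_div_iff₀ hd (by positivity)]
      have hk : 0 < 1 - c ^ 2 := by nlinarith
      have : 0 ≤ sin θ ^ 2 * (c ^ 2 * c ^ 2 + (1 - c ^ 2) * sin θ ^ 2) := by positivity
      nlinarith
    _ ≤ (π - θ) ^ 2 / c ^ 2 := by gcongr

lemma le_anglePeriod {c θ : ℝ} (h0 : 0 < c) (h1 : c < 1) (hθ : θ ∈ Ico (π / 2) π) :
    c / 2 * log (π / 2 / (π - θ)) ≤ anglePeriod c θ := by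
  have hπ := Real.pi_pos
  have hθ' : θ ∈ Ioo 0 π := ⟨by linarith [hθ.1], hθ.2⟩
  have hp := amp_pos h0 h1 θ
  have hl := amp_lt_one h0 h1 hθ'
  have hi := intervalIntegrable_kern_mul_cos hp.le hl
  have hlog : ∫ t in (π / 2)..θ, (π - t)⁻¹ = log (π / 2 / (π - θ)) := by
    rw [intervalIntegral.integral_comp_sub_left (fun t => t⁻¹) π,
      integral_inv_of_pos (by linarith [hθ.2]) (by linarith)]
    congr 2
    ring
  have hnn : 0 ≤ ∫ t in 0..(π / 2), kern (amp c θ * cos t) :=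
    intervalIntegral.integral_nonneg (by linarith)
      fun t _ => (kern_pos (neg_one_lt_mul_cos hp.le hl t)).le
  rw [anglePeriod, ← intervalIntegral.integral_add_adjacent_intervals (hi 0 (π / 2)) (hi (π / 2) θ),
    ← hlog, ← intervalIntegral.integral_const_mul]
  refine le_add_of_nonneg_of_le hnn (intervalIntegral.integral_mono_on hθ.1 ?_ (hi _ _) ?_)
  · refine ContinuousOn.intervalIntegrable ?_
    rw [uIcc_of_le hθ.1]
    refine continuousOn_const.mul (ContinuousOn.inv₀ (by fun_prop) fun t ht => ?_)
    linarith [ht.2, hθ.2]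
  · intro t ht
    have ht0 : 0 < π - t := by linarith [ht.2, hθ.2]
    have hb := neg_one_lt_mul_cos hp.le hl t
    rw [kern, show c / 2 * (π - t)⁻¹ = (2 / c * (π - t))⁻¹ by field_simp]
    apply inv_anti₀ (Real.sqrt_pos.2 (by linarith))
    apply Real.sqrt_le_iff.2 ⟨by positivity, ?_⟩
    have hcos : -cos t ≥ 1 - (π - t) ^ 2 / 2 := by
      rw [← Real.cos_pi_sub]
      exact Real.one_sub_sq_div_two_le_cos
    have hamp := one_sub_amp_le h0 h1 hθ'
    have hsq : (π - θ) ^ 2 / c ^ 2 ≤ (π - t) ^ 2 / c ^ 2 := by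
      have : 0 ≤ π - θ := by linarith [hθ.2]
      have := ht.2
      gcongr
    have hc2 : (π - t) ^ 2 ≤ (π - t) ^ 2 / c ^ 2 := by
      rw [le_div_iff₀ (by positivity)]
      exact mul_le_of_le_one_right (sq_nonneg _) (by nlinarith)
    have hm : amp c θ * (1 + cos t) ≤ (π - t) ^ 2 / 2 := by
      nlinarith [Real.neg_one_le_cos t]
    have : (2 / c * (π - t)) ^ 2 = 4 * ((π - t) ^ 2 / c ^ 2) := by
      field_simp
      ring
    nlinarith [sq_nonneg (π - t)]

lemma tendsto_anglePeriod_pi {c : ℝ} (h0 : 0 < c) (h1 : c < 1) :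
    Tendsto (anglePeriod c) (𝓝[<] π) atTop := by
  have hπ := Real.pi_pos
  have hmem : ∀ᶠ θ in 𝓝[<] π, θ ∈ Ioo (π / 2) π := Ioo_mem_nhdsLT (by linarith)
  have hlim : Tendsto (fun θ => π - θ) (𝓝[<] π) (𝓝[>] 0) := by
    refine tendsto_nhdsWithin_iff.2 ⟨?_, ?_⟩
    · have : Tendsto (fun θ => π - θ) (𝓝 π) (𝓝 (π - π)) := (continuous_sub_left π).tendsto π
      rw [sub_self] at this
      exact this.mono_left nhdsWithin_le_nhds
    · filter_upwards [hmem] with θ hθ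
      exact sub_pos.2 hθ.2
  have hdiv : Tendsto (fun θ => π / 2 / (π - θ)) (𝓝[<] π) atTop := by
    simp only [div_eq_mul_inv (π / 2)]
    exact (tendsto_inv_nhdsGT_zero.comp hlim).const_mul_atTop (by linarith)
  refine tendsto_atTop_mono' _ ?_
    ((Real.tendsto_log_atTop.comp hdiv).const_mul_atTop (half_pos h0))
  filter_upwards [hmem] with θ hθ
  exact le_anglePeriod h0 h1 ⟨hθ.1.le, hθ.2⟩

/-- The modulus `D` as a function of the initial position `p`. -/
noncomputable def modulus (c p : ℝ) : ℝ := √(c ^ 2 + (1 - c ^ 2) * (2 * p ^ 2 - 1) ^ 2)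

/-- The limiting angle corresponding to the initial position `p`. -/
noncomputable def initialAngle (c p : ℝ) : ℝ := arccos ((2 * p ^ 2 - 1) / modulus c p)

lemma modulus_sq {c : ℝ} (h0 : 0 < c) (h1 : c < 1) (p : ℝ) :
    modulus c p ^ 2 = c ^ 2 + (1 - c ^ 2) * (2 * p ^ 2 - 1) ^ 2 := by
  have : 0 < 1 - c ^ 2 := by nlinarith
  exact Real.sq_sqrt (by positivity)

lemma modulus_pos {c : ℝ} (h0 : 0 < c) (h1 : c < 1) (p : ℝ) : 0 < modulus c p := by
  have : 0 < 1 - c ^ 2 := by nlinarith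
  exact Real.sqrt_pos.2 (by positivity)

lemma abs_lt_modulus {c p : ℝ} (h0 : 0 < c) (h1 : c < 1) (hp : p ∈ Ioo (0 : ℝ) 1) :
    |2 * p ^ 2 - 1| < modulus c p := by
  have hp0 := hp.1
  have hp1 := hp.2
  have h2 : 0 < 1 - p ^ 2 := by nlinarith
  have : 0 < c ^ 2 * (p ^ 2 * (1 - p ^ 2)) := by positivity
  refine abs_lt_of_sq_lt_sq ?_ (modulus_pos h0 h1 p).le
  rw [modulus_sq h0 h1]
  nlinarith

lemma initialAngle_mem {c p : ℝ} (h0 : 0 < c) (h1 : c < 1) (hp : p ∈ Ioo (0 : ℝ) 1) :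
    initialAngle c p ∈ Ioo 0 π := by
  have hm := modulus_pos h0 h1 p
  have h := abs_lt.1 (abs_lt_modulus h0 h1 hp)
  refine ⟨Real.arccos_pos.2 ((div_lt_one hm).2 h.2), Real.arccos_lt_pi.2 ?_⟩
  rw [lt_div_iff₀ hm]
  linarith

lemma modulus_mul_cos {c p : ℝ} (h0 : 0 < c) (h1 : c < 1) (hp : p ∈ Ioo (0 : ℝ) 1) :
    modulus c p * cos (initialAngle c p) = 2 * p ^ 2 - 1 := by
  have hm := modulus_pos h0 h1 p
  have h := abs_lt.1 (abs_lt_modulus h0 h1 hp)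
  rw [initialAngle, Real.cos_arccos, mul_div_cancel₀ _ hm.ne']
  · rw [le_div_iff₀ hm]
    linarith
  · exact (div_le_one hm).2 h.2.le

lemma amp_initialAngle {c p : ℝ} (h0 : 0 < c) (h1 : c < 1) (hp : p ∈ Ioo (0 : ℝ) 1) :
    amp c (initialAngle c p) = modulus c p := by
  have hm := modulus_pos h0 h1 p
  have hd := amp_denom_pos h0 h1 (initialAngle c p)
  have hsq := modulus_sq h0 h1 p
  rw [← modulus_mul_cos h0 h1 hp] at hsq
  rw [amp, div_eq_iff (Real.sqrt_pos.2 hd).ne', ← sq_eq_sq₀ h0.le (by positivity), mul_pow,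
    Real.sq_sqrt hd.le]
  have := Real.sin_sq_add_cos_sq (initialAngle c p)
  rw [show sin (initialAngle c p) ^ 2 = 1 - cos (initialAngle c p) ^ 2 by linarith]
  linarith

lemma injOn_initialAngle {c : ℝ} (h0 : 0 < c) (h1 : c < 1) :
    InjOn (initialAngle c) (Ioo 0 1) := by
  intro p hp q hq h
  have hp' := modulus_mul_cos h0 h1 hp
  have hq' := modulus_mul_cos h0 h1 hq
  rw [← amp_initialAngle h0 h1 hp, h] at hp'
  rw [← amp_initialAngle h0 h1 hq] at hq'
  have : p ^ 2 = q ^ 2 := by linarith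
  exact (sq_eq_sq₀ hp.1.le hq.1.le).1 this

lemma continuous_initialAngle {c : ℝ} (h0 : 0 < c) (h1 : c < 1) : Continuous (initialAngle c) := by
  have : Continuous (modulus c) := by
    unfold modulus
    fun_prop
  exact Real.continuous_arccos.comp
    (Continuous.div (by fun_prop) this fun p => (modulus_pos h0 h1 p).ne')

lemma initialAngle_zero (c : ℝ) : initialAngle c 0 = π := by
  simp [initialAngle, modulus]

lemma initialAngle_one (c : ℝ) : initialAngle c 1 = 0 := by
  norm_num [initialAngle, modulus]

lemma Tplus_eq_anglePeriod {c p : ℝ} (h0 : 0 < c) (h1 : c < 1) (hp : p ∈ Ioo (0 : ℝ) 1) :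
    Tplus p (c * √(A p)) = (√2)⁻¹ * anglePeriod c (initialAngle c p) := by
  have hp0 := hp.1
  have hA : 0 ≤ A p := by
    have : 0 ≤ 1 - p ^ 2 := by nlinarith [hp.2]
    unfold A
    positivity
  have hθ := initialAngle_mem h0 h1 hp
  have hamp := amp_initialAngle h0 h1 hp
  have hsq := modulus_sq h0 h1 p
  have hE : (c * √(A p)) ^ 2 - A p = (modulus c p ^ 2 - 1) / 4 := by
    rw [mul_pow, Real.sq_sqrt hA, hsq, A]
    ring
  have hpl : pPlus ((modulus c p ^ 2 - 1) / 4) = √((1 + modulus c p) / 2) := by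
    rw [pPlus, show 1 + 4 * ((modulus c p ^ 2 - 1) / 4) = modulus c p ^ 2 by ring,
      Real.sqrt_sq (modulus_pos h0 h1 p).le]
  have hpp : p = √((1 + modulus c p * cos (initialAngle c p)) / 2) := by
    rw [modulus_mul_cos h0 h1 hp, show (1 + (2 * p ^ 2 - 1)) / 2 = p ^ 2 by ring,
      Real.sqrt_sq hp0.le]
  have h := integral_inv_sqrt_add_A (modulus_pos h0 h1 p) (hamp ▸ amp_lt_one h0 h1 hθ) hθ
  rw [← hpp] at h
  rw [Tplus, hE, hpl, h, anglePeriod, hamp]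

/-- for every integer `N ≥ 1`, `𝒯(p₀) → 0` as `p₀ → 1⁻`, `𝒯(p₀) → ∞` as
`p₀ → 0⁺`, and `𝒯` is a bijection from `(0,1)` onto `(0,∞)`. -/
theorem calT_limits_and_bijective (N : ℕ) (hN : 1 ≤ N) :
    Tendsto (calT N) (nhdsWithin 1 (Set.Iio 1)) (nhds 0) ∧
    Tendsto (calT N) (nhdsWithin 0 (Set.Ioi 0)) atTop ∧
    Set.BijOn (calT N) (Set.Ioo 0 1) (Set.Ioi 0) := by
  have hN' : (1 : ℝ) ≤ N := by exact_mod_cast hN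
  set c : ℝ := 1 / (2 * (N : ℝ)) with hc
  have h0 : 0 < c := by positivity
  have h1 : c < 1 := by
    rw [hc, div_lt_one (by positivity)]
    linarith
  have heq : EqOn (calT N) (fun p => (√2)⁻¹ * anglePeriod c (initialAngle c p)) (Ioo 0 1) :=
    fun p hp => Tplus_eq_anglePeriod h0 h1 hp
  have hmaps : MapsTo (initialAngle c) (Ioo 0 1) (Ioo 0 π) := fun p hp => initialAngle_mem h0 h1 hp
  have hcont := continuous_initialAngle h0 h1
  have hs : 0 < (√2)⁻¹ := by positivity
  have hleft : Ioo (0 : ℝ) 1 ∈ 𝓝[<] (1 : ℝ) := Ioo_mem_nhdsLT one_pos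
  have hright : Ioo (0 : ℝ) 1 ∈ 𝓝[>] (0 : ℝ) := Ioo_mem_nhdsGT one_pos
  have hangle1 : Tendsto (initialAngle c) (𝓝[<] 1) (𝓝[>] 0) := by
    refine tendsto_nhdsWithin_iff.2 ⟨?_, ?_⟩
    · have := hcont.tendsto 1
      rw [initialAngle_one] at this
      exact this.mono_left nhdsWithin_le_nhds
    · filter_upwards [hleft] with p hp using (hmaps hp).1
  have hangle0 : Tendsto (initialAngle c) (𝓝[>] 0) (𝓝[<] π) := by
    refine tendsto_nhdsWithin_iff.2 ⟨?_, ?_⟩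
    · have := hcont.tendsto 0
      rw [initialAngle_zero] at this
      exact this.mono_left nhdsWithin_le_nhds
    · filter_upwards [hright] with p hp using (hmaps hp).2
  have hlim1 : Tendsto (calT N) (𝓝[<] 1) (𝓝 0) := by
    have := ((tendsto_anglePeriod_zero h0 h1).comp hangle1).const_mul (√2)⁻¹
    rw [mul_zero] at this
    exact this.congr' (heq.symm.eventuallyEq_of_mem hleft)
  have hlim0 : Tendsto (calT N) (𝓝[>] 0) atTop :=
    (((tendsto_anglePeriod_pi h0 h1).comp hangle0).const_mul_atTop hs).congr'
      (heq.symm.eventuallyEq_of_mem hright)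
  refine ⟨hlim1, hlim0, BijOn.mk ?_ ?_ ?_⟩
  · intro p hp
    rw [heq hp]
    exact mul_pos hs (anglePeriod_pos h0 h1 (hmaps hp))
  · refine InjOn.congr ?_ heq.symm
    intro p hp q hq h
    exact injOn_initialAngle h0 h1 hp hq ((anglePeriod_strictMonoOn h0 h1).injOn (hmaps hp)
      (hmaps hq) (mul_left_cancel₀ hs.ne' h))
  · have hcontT : ContinuousOn (calT N) (Ioo 0 1) :=
      (continuousOn_const.mul ((continuousOn_anglePeriod h0 h1).comp hcont.continuousOn hmaps)).congr
        heq
    exact isPreconnected_Ioo.intermediate_value_Ioi (le_principal_iff.2 hleft)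
      (le_principal_iff.2 hright) hcontT hlim1 hlim0
end

section
/- For every fixed p₀ ∈ (p_*, 1), the function q₀ ↦ T₊(p₀, q₀) on (0,∞) satisfies T₊(p₀, q₀) → 0 as q₀ → 0⁺ and T₊(p₀, q₀) → 0 as q₀ → ∞; since T₊(p₀,q₀) > 0 for q₀ > 0, the function is non-monotone and attains an interior maximum in q₀. -/
open Real MeasureTheory Set Filter Topology

/-- After the substitution `u = p + (P - p) s`, the integrand of the period function with endpoint
`P = p₊` on the unit interval. -/
noncomputable def unitIntegrand (p P s : ℝ) : ℝ :=
  √((P - p) / ((1 - s) * ((P + (p + (P - p) * s)) * (P ^ 2 + (p + (P - p) * s) ^ 2 - 1))))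

lemma unitIntegrand_nonneg (p P s : ℝ) : 0 ≤ unitIntegrand p P s :=
  Real.sqrt_nonneg _

lemma half_lt_sq_of_pstar_lt {p : ℝ} (hp : pstar < p) : 1 / 2 < p ^ 2 := by
  have h0 : 0 < pstar := by unfold pstar; positivity
  have h1 : pstar ^ 2 = 1 / 2 := by
    unfold pstar
    rw [div_pow, Real.sq_sqrt (by norm_num)]
    norm_num
  nlinarith

lemma pPlus_sq (E : ℝ) : pPlus E ^ 2 = (1 + √(1 + 4 * E)) / 2 :=
  Real.sq_sqrt (by positivity)

lemma continuous_pPlus : Continuous pPlus := by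
  unfold pPlus
  fun_prop

lemma A_pPlus {E : ℝ} (hE : -(1 / 4) ≤ E) : A (pPlus E) = -E := by
  have h : √(1 + 4 * E) ^ 2 = 1 + 4 * E := Real.sq_sqrt (by linarith)
  unfold A
  rw [pPlus_sq]
  linear_combination -(1 / 4) * h

lemma neg_quarter_le_energy (p q : ℝ) : -(1 / 4) ≤ q ^ 2 - A p := by
  unfold A
  nlinarith [sq_nonneg (2 * p ^ 2 - 1), sq_nonneg q]

lemma le_pPlus (p q : ℝ) : p ≤ pPlus (q ^ 2 - A p) := by
  have h : 2 * p ^ 2 - 1 ≤ √(1 + 4 * (q ^ 2 - A p)) := by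
    apply Real.le_sqrt_of_sq_le
    unfold A
    nlinarith [sq_nonneg q]
  apply Real.le_sqrt_of_sq_le
  linarith

lemma lt_pPlus (p : ℝ) {q : ℝ} (hq : 0 < q) : p < pPlus (q ^ 2 - A p) := by
  have h : 2 * p ^ 2 - 1 < √(1 + 4 * (q ^ 2 - A p)) := by
    apply Real.lt_sqrt_of_sq_lt
    unfold A
    nlinarith [pow_pos hq 2]
  apply Real.lt_sqrt_of_sq_lt
  linarith

lemma pPlus_zero_energy {p : ℝ} (hp0 : 0 < p) (hp : 1 / 2 < p ^ 2) :
    pPlus (0 ^ 2 - A p) = p := by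
  have h : √(1 + 4 * (0 ^ 2 - A p)) = 2 * p ^ 2 - 1 := by
    rw [← Real.sqrt_sq (show 0 ≤ 2 * p ^ 2 - 1 by linarith)]
    congr 1
    unfold A
    ring
  unfold pPlus
  rw [h, show (1 + (2 * p ^ 2 - 1)) / 2 = p ^ 2 by ring, Real.sqrt_sq hp0.le]

lemma le_pPlus_sq (p q : ℝ) : q ≤ pPlus (q ^ 2 - A p) ^ 2 := by
  have h : 2 * q ≤ √(1 + 4 * (q ^ 2 - A p)) := by
    apply Real.le_sqrt_of_sq_le
    unfold A
    nlinarith [sq_nonneg (2 * p ^ 2 - 1)]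
  rw [pPlus_sq]
  linarith

lemma Tplus_eq_integral_unitIntegrand (p q : ℝ) :
    Tplus p q = ∫ s in (0 : ℝ)..1, unitIntegrand p (pPlus (q ^ 2 - A p)) s := by
  have hA := A_pPlus (neg_quarter_le_energy p q)
  have hle := le_pPlus p q
  unfold Tplus
  set E := q ^ 2 - A p
  set P := pPlus E
  have hsub := intervalIntegral.mul_integral_comp_add_mul (a := 0) (b := 1)
    (f := fun u => 1 / √(E + A u)) (P - p) p
  rw [mul_zero, add_zero, mul_one, add_sub_cancel] at hsub
  rw [← hsub, ← intervalIntegral.integral_const_mul]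
  refine intervalIntegral.integral_congr fun s _ => ?_
  have hfac : E + A (p + (P - p) * s) = (P - p) *
      ((1 - s) * ((P + (p + (P - p) * s)) * (P ^ 2 + (p + (P - p) * s) ^ 2 - 1))) := by
    have hE : E = -A P := by linarith
    rw [hE]
    unfold A
    ring
  simp only [unitIntegrand]
  rw [hfac, Real.sqrt_mul (sub_nonneg.2 hle), Real.sqrt_div (sub_nonneg.2 hle), mul_one_div,
    ← div_div, Real.div_sqrt]

lemma factors_pos {p P s : ℝ} (hp0 : 0 < p) (hp : 1 / 2 < p ^ 2) (hP : p ≤ P) (hs : 0 ≤ s) :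
    0 < P + (p + (P - p) * s) ∧ 0 < P ^ 2 + (p + (P - p) * s) ^ 2 - 1 := by
  have hu : 0 ≤ (P - p) * s := mul_nonneg (sub_nonneg.2 hP) hs
  constructor <;> nlinarith

lemma unitIntegrand_le {p P s : ℝ} (hp0 : 0 < p) (hp : 1 / 2 < p ^ 2) (hP : p ≤ P)
    (hs : s ∈ Ico (0 : ℝ) 1) :
    unitIntegrand p P s ≤ (√(P ^ 2 + p ^ 2 - 1))⁻¹ * (√(1 - s))⁻¹ := by
  obtain ⟨h1, h2⟩ := factors_pos hp0 hp hP hs.1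
  have hu : 0 ≤ (P - p) * s := mul_nonneg (sub_nonneg.2 hP) hs.1
  have hs1 : 0 < 1 - s := sub_pos.2 hs.2
  have hc : 0 < P ^ 2 + p ^ 2 - 1 := by nlinarith
  rw [← Real.sqrt_inv, ← Real.sqrt_inv, ← Real.sqrt_mul (by positivity), ← mul_inv]
  refine Real.sqrt_le_sqrt ?_
  calc _ ≤ (P + (p + (P - p) * s)) /
        ((1 - s) * ((P + (p + (P - p) * s)) * (P ^ 2 + (p + (P - p) * s) ^ 2 - 1))) := by
        gcongr
        linarith
    _ = ((P ^ 2 + (p + (P - p) * s) ^ 2 - 1) * (1 - s))⁻¹ := by field_simp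
    _ ≤ _ := by
        gcongr
        linarith

lemma unitIntegrand_le_of_le {p P s : ℝ} (hp0 : 0 < p) (hp : 1 / 2 < p ^ 2) (hP : p ≤ P)
    (hs : s ∈ Ico (0 : ℝ) 1) :
    unitIntegrand p P s ≤ (√(p ^ 2 + p ^ 2 - 1))⁻¹ * (√(1 - s))⁻¹ := by
  have hc : 0 < √(p ^ 2 + p ^ 2 - 1) := Real.sqrt_pos.2 (by linarith)
  refine (unitIntegrand_le hp0 hp hP hs).trans ?_
  gcongr

lemma intervalIntegrable_inv_sqrt_one_sub :
    IntervalIntegrable (fun s : ℝ => (√(1 - s))⁻¹) volume 0 1 := by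
  have h := (intervalIntegral.intervalIntegrable_rpow' (a := 0) (b := 1)
    (show (-1 : ℝ) < -(1 / 2) by norm_num)).comp_sub_left 1
  rw [sub_zero, sub_self] at h
  refine h.symm.congr fun s hs => ?_
  rw [uIoc_of_le zero_le_one] at hs
  rw [Real.rpow_neg (by linarith [hs.2]), ← Real.sqrt_eq_rpow]

lemma ae_mem_Ico_of_mem_uIoc :
    ∀ᵐ s : ℝ, s ∈ uIoc (0 : ℝ) 1 → s ∈ Ico (0 : ℝ) 1 := by
  filter_upwards [compl_mem_ae_iff.2 (measure_singleton (1 : ℝ))] with s hs1 hs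
  rw [uIoc_of_le zero_le_one] at hs
  exact ⟨hs.1.le, lt_of_le_of_ne hs.2 hs1⟩

lemma measurable_unitIntegrand (p P : ℝ) : Measurable (unitIntegrand p P) := by
  unfold unitIntegrand
  fun_prop

lemma intervalIntegrable_unitIntegrand {p P : ℝ} (hp0 : 0 < p) (hp : 1 / 2 < p ^ 2)
    (hP : p ≤ P) : IntervalIntegrable (unitIntegrand p P) volume 0 1 := by
  refine (intervalIntegrable_inv_sqrt_one_sub.const_mul (√(P ^ 2 + p ^ 2 - 1))⁻¹).mono_fun'
    (measurable_unitIntegrand p P).aestronglyMeasurable ?_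
  refine (ae_restrict_iff' measurableSet_uIoc).2 ?_
  filter_upwards [ae_mem_Ico_of_mem_uIoc] with s hs hs'
  rw [Real.norm_of_nonneg (unitIntegrand_nonneg _ _ _)]
  exact unitIntegrand_le hp0 hp hP (hs hs')

lemma continuous_Tplus {p : ℝ} (hp0 : 0 < p) (hp : 1 / 2 < p ^ 2) : Continuous (Tplus p) := by
  have hcP : Continuous fun q : ℝ => pPlus (q ^ 2 - A p) :=
    continuous_pPlus.comp (by fun_prop)
  rw [funext (Tplus_eq_integral_unitIntegrand p)]
  refine intervalIntegral.continuous_of_dominated_interval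
    (fun q => (measurable_unitIntegrand p _).aestronglyMeasurable) (fun q => ?_)
    (intervalIntegrable_inv_sqrt_one_sub.const_mul (√(p ^ 2 + p ^ 2 - 1))⁻¹) ?_
  · filter_upwards [ae_mem_Ico_of_mem_uIoc] with s hs hs'
    rw [Real.norm_of_nonneg (unitIntegrand_nonneg _ _ _)]
    exact unitIntegrand_le_of_le hp0 hp (le_pPlus p q) (hs hs')
  · filter_upwards [ae_mem_Ico_of_mem_uIoc] with s hs hs'
    unfold unitIntegrand
    refine (Continuous.div (by fun_prop) (by fun_prop) fun q => ?_).sqrt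
    obtain ⟨h1, h2⟩ := factors_pos hp0 hp (le_pPlus p q) (hs hs').1
    exact mul_ne_zero (sub_ne_zero.2 (hs hs').2.ne') (mul_pos h1 h2).ne'

lemma Tplus_zero {p : ℝ} (hp0 : 0 < p) (hp : 1 / 2 < p ^ 2) : Tplus p 0 = 0 := by
  unfold Tplus
  rw [pPlus_zero_energy hp0 hp, intervalIntegral.integral_same]

lemma Tplus_nonneg (p q : ℝ) : 0 ≤ Tplus p q := by
  rw [Tplus_eq_integral_unitIntegrand]
  exact intervalIntegral.integral_nonneg zero_le_one fun s _ => unitIntegrand_nonneg _ _ _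

lemma Tplus_pos {p q : ℝ} (hp0 : 0 < p) (hp : 1 / 2 < p ^ 2) (hq : 0 < q) : 0 < Tplus p q := by
  have hP := lt_pPlus p hq
  rw [Tplus_eq_integral_unitIntegrand]
  refine intervalIntegral.intervalIntegral_pos_of_pos_on
    (intervalIntegrable_unitIntegrand hp0 hp hP.le) (fun s hs => ?_) zero_lt_one
  obtain ⟨h1, h2⟩ := factors_pos hp0 hp hP.le hs.1.le
  exact Real.sqrt_pos.2
    (div_pos (sub_pos.2 hP) (mul_pos (sub_pos.2 hs.2) (mul_pos h1 h2)))

lemma tendsto_Tplus_atTop {p : ℝ} (hp0 : 0 < p) (hp : 1 / 2 < p ^ 2) :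
    Tendsto (Tplus p) atTop (𝓝 0) := by
  have hlim : Tendsto (fun q : ℝ => (√(q - 1))⁻¹ * ∫ s in (0 : ℝ)..1, (√(1 - s))⁻¹)
      atTop (𝓝 0) := by
    have h := (tendsto_inv_atTop_zero.comp (Real.tendsto_sqrt_atTop.comp
      (tendsto_atTop_add_const_right _ (-1) tendsto_id))).mul_const
      (∫ s in (0 : ℝ)..1, (√(1 - s))⁻¹)
    rwa [zero_mul] at h
  refine squeeze_zero' (Eventually.of_forall (Tplus_nonneg p)) ?_ hlim
  filter_upwards [eventually_gt_atTop 1] with q hq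
  rw [Tplus_eq_integral_unitIntegrand, ← intervalIntegral.integral_const_mul]
  refine intervalIntegral.integral_mono_on_of_le_Ioo zero_le_one
    (intervalIntegrable_unitIntegrand hp0 hp (le_pPlus p q))
    (intervalIntegrable_inv_sqrt_one_sub.const_mul _) fun s hs => ?_
  refine (unitIntegrand_le hp0 hp (le_pPlus p q) ⟨hs.1.le, hs.2⟩).trans ?_
  have h := le_pPlus_sq p q
  have hc : 0 < √(q - 1) := Real.sqrt_pos.2 (sub_pos.2 hq)
  gcongr
  nlinarith

/-- for every fixed `p₀ ∈ (p⋆, 1)`, `T₊(p₀,q₀) → 0` as `q₀ → 0⁺` and as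
`q₀ → ∞`; `T₊(p₀,q₀) > 0` for `q₀ > 0`; the function is non-monotone on `(0,∞)` and attains
an interior maximum there. -/
theorem Tplus_nonmonotone_in_q (p₀ : ℝ) (hp₀ : p₀ ∈ Set.Ioo pstar 1) :
    Tendsto (fun q₀ => Tplus p₀ q₀) (nhdsWithin 0 (Set.Ioi 0)) (nhds 0) ∧
    Tendsto (fun q₀ => Tplus p₀ q₀) atTop (nhds 0) ∧
    (∀ q₀ ∈ Set.Ioi (0 : ℝ), 0 < Tplus p₀ q₀) ∧
    ¬ MonotoneOn (fun q₀ => Tplus p₀ q₀) (Set.Ioi 0) ∧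
    ¬ AntitoneOn (fun q₀ => Tplus p₀ q₀) (Set.Ioi 0) ∧
    ∃ qmax ∈ Set.Ioi (0 : ℝ), ∀ q₀ ∈ Set.Ioi (0 : ℝ), Tplus p₀ q₀ ≤ Tplus p₀ qmax := by
  have hp : 1 / 2 < p₀ ^ 2 := half_lt_sq_of_pstar_lt hp₀.1
  have hp0 : 0 < p₀ := lt_trans (by unfold pstar; positivity) hp₀.1
  have hcont := continuous_Tplus hp0 hp
  have hzero : Tendsto (Tplus p₀) (𝓝[>] 0) (𝓝 0) := by
    have h := hcont.tendsto 0
    rw [Tplus_zero hp0 hp] at h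
    exact h.mono_left nhdsWithin_le_nhds
  have htop := tendsto_Tplus_atTop hp0 hp
  have hpos : ∀ q ∈ Ioi (0 : ℝ), 0 < Tplus p₀ q := fun q hq => Tplus_pos hp0 hp hq
  have h01 : (1 : ℝ) ∈ Ioi 0 := mem_Ioi.2 zero_lt_one
  have hone : 0 < Tplus p₀ 1 := hpos 1 h01
  refine ⟨hzero, htop, hpos, fun hmono => ?_, fun hanti => ?_, ?_⟩
  · obtain ⟨q, hq, hq1⟩ := ((htop.eventually_lt_const hone).and (eventually_ge_atTop 1)).exists
    exact (hmono h01 (one_pos.trans_le hq1) hq1).not_gt hq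
  · obtain ⟨q, hq, hq0, hq1⟩ :=
      ((hzero.eventually_lt_const hone).and (Ioo_mem_nhdsGT one_pos)).exists
    exact (hanti hq0 h01 hq1.le).not_gt hq
  · obtain ⟨R, hR⟩ := eventually_atTop.1 (htop.eventually_lt_const hone)
    obtain ⟨m, hm, hmax⟩ := isCompact_Icc.exists_isMaxOn
      (⟨1, zero_le_one, le_max_left 1 R⟩ : (Icc 0 (max 1 R)).Nonempty) hcont.continuousOn
    have hm1 : Tplus p₀ 1 ≤ Tplus p₀ m := hmax ⟨zero_le_one, le_max_left 1 R⟩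
    have hm0 : m ≠ 0 := by
      rintro rfl
      rw [Tplus_zero hp0 hp] at hm1
      exact hm1.not_gt hone
    refine ⟨m, lt_of_le_of_ne hm.1 hm0.symm, fun q hq => ?_⟩
    rcases le_total q (max 1 R) with h | h
    · exact hmax ⟨le_of_lt hq, h⟩
    · exact ((hR q ((le_max_right 1 R).trans h)).le).trans hm1
end

section
/- There are no two distinct points (p₁, q₁) and (p₂, q₂) in (0,1) × (0,∞) with equal energies q₁² − A(p₁) = q₂² − A(p₂) such that ∂T₊/∂q₀(p₁, q₁) = 0 and ∂T₊/∂q₀(p₂, q₂) = 0. -/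
open Real MeasureTheory Set Filter Topology

lemma hasDerivAt_integral_one_div_sqrt_affine {c d : ℝ → ℝ} (hc : Continuous c)
    (hd : Continuous d) {a b x₀ : ℝ} (hpos : ∀ t ∈ uIcc a b, 0 < c t + x₀ * d t) :
    HasDerivAt (fun x => ∫ t in a..b, 1 / √(c t + x * d t))
      (∫ t in a..b, -d t / (2 * √(c t + x₀ * d t) ^ 3)) x₀ := by
  obtain ⟨t₀, ht₀, hmin⟩ := isCompact_uIcc.exists_isMinOn (nonempty_uIcc (a := a) (b := b))
    (f := fun t => c t + x₀ * d t) (by fun_prop)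
  obtain ⟨M, hM⟩ := isCompact_uIcc.exists_bound_of_continuousOn
    (hd.continuousOn (s := uIcc a b))
  set m := c t₀ + x₀ * d t₀
  have hm0 : 0 < m := hpos t₀ ht₀
  have hM0 : 0 ≤ M := (norm_nonneg _).trans (hM t₀ ht₀)
  have hlow : ∀ t ∈ uIcc a b, ∀ x ∈ Metric.ball x₀ (m / (2 * (M + 1))),
      m / 2 ≤ c t + x * d t := by
    intro t ht x hx
    have h1 : m ≤ c t + x₀ * d t := hmin ht
    have h2 : |x - x₀| < m / (2 * (M + 1)) := by simpa [Real.dist_eq] using hx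
    have h3 : |(x - x₀) * d t| ≤ m / (2 * (M + 1)) * (M + 1) := by
      rw [abs_mul]
      have := hM t ht
      rw [Real.norm_eq_abs] at this
      gcongr
      linarith
    have h4 : m / (2 * (M + 1)) * (M + 1) = m / 2 := by field_simp
    rw [h4] at h3
    have := neg_abs_le ((x - x₀) * d t)
    linarith
  have hr : 0 < m / (2 * (M + 1)) := by positivity
  refine (intervalIntegral.hasDerivAt_integral_of_dominated_loc_of_deriv_le
    (F := fun x t => 1 / √(c t + x * d t))
    (F' := fun x t => -d t / (2 * √(c t + x * d t) ^ 3))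
    (bound := fun _ => M / (2 * √(m / 2) ^ 3)) (Metric.ball_mem_nhds x₀ hr)
    ?_ ?_ ?_ ?_ ?_ ?_).2
  · refine Eventually.of_forall fun x => Measurable.aestronglyMeasurable ?_
    fun_prop
  · refine ContinuousOn.intervalIntegrable (ContinuousOn.div (by fun_prop) (by fun_prop) ?_)
    exact fun t ht => (Real.sqrt_pos.2 (hpos t ht)).ne'
  · refine Measurable.aestronglyMeasurable ?_
    fun_prop
  · refine Eventually.of_forall fun t ht x hx => ?_
    have ht' := uIoc_subset_uIcc ht
    have h1 := hlow t ht' x hx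
    have h2 : 0 < √(m / 2) := Real.sqrt_pos.2 (by positivity)
    rw [norm_div, norm_neg, Real.norm_of_nonneg (by positivity : 0 ≤ 2 * √(c t + x * d t) ^ 3)]
    have := hM t ht'
    gcongr
  · exact intervalIntegrable_const
  · refine Eventually.of_forall fun t ht x hx => ?_
    have h1 := hlow t (uIoc_subset_uIcc ht) x hx
    have h0 : 0 < c t + x * d t := by linarith [half_pos hm0]
    have hs : 0 < √(c t + x * d t) := Real.sqrt_pos.2 h0
    have hlin : HasDerivAt (fun x => c t + x * d t) (d t) x := by
      simpa using ((hasDerivAt_id x).mul_const (d t)).const_add (c t)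
    have h3 := (hlin.sqrt h0.ne').inv hs.ne'
    simp only [one_div]
    have h4 : -d t / (2 * √(c t + x * d t) ^ 3) =
        -(d t / (2 * √(c t + x * d t))) / √(c t + x * d t) ^ 2 := by
      field_simp
    rw [h4]
    exact h3

lemma continuous_A : Continuous A := by unfold A; fun_prop

lemma pstar_pos : 0 < pstar := by unfold pstar; positivity

lemma pstar_sq : pstar ^ 2 = 1 / 2 := by
  simp [pstar]

/-- The substitution `u² = 1/2 + s sin θ` with `s = √(1 + 4E) / 2` removes the endpoint
singularity of the period integral. -/
lemma integral_pstar_pPlus {E : ℝ} (hE : -(1 / 4) < E) :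
    IntervalIntegrable (fun u => 1 / √(E + A u)) volume pstar (pPlus E) ∧
    ∫ u in pstar..pPlus E, 1 / √(E + A u) =
      ∫ θ in (0 : ℝ)..(π / 2), (1 / 2) * (1 / √(1 / 2 + √(1 + 4 * E) / 2 * sin θ)) := by
  set s := √(1 + 4 * E) / 2 with hs
  have hs0 : 0 < s := by
    have : 0 < √(1 + 4 * E) := Real.sqrt_pos.2 (by linarith)
    positivity
  have hsE : E = s ^ 2 - 1 / 4 := by
    rw [hs, div_pow, Real.sq_sqrt (by linarith)]; ring
  let f : ℝ → ℝ := fun θ => √(1 / 2 + s * sin θ)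
  let f' : ℝ → ℝ := fun θ => s * cos θ / (2 * √(1 / 2 + s * sin θ))
  have hpi := Real.pi_pos
  have hf0 : f 0 = pstar := by simp [f, pstar]
  have hf1 : f (π / 2) = pPlus E := by
    simp only [f, pPlus, Real.sin_pi_div_two, hs]
    congr 1
    ring
  have hcont : Continuous f := by fun_prop
  have hbase : ∀ θ ∈ Icc 0 (π / 2), 0 < 1 / 2 + s * sin θ := fun θ hθ => by
    have : 0 ≤ sin θ := Real.sin_nonneg_of_nonneg_of_le_pi hθ.1 (by linarith [hθ.2])
    positivity
  have hmono : StrictMonoOn f (Icc 0 (π / 2)) := fun x hx y hy hxy => by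
    have : sin x < sin y :=
      Real.strictMonoOn_sin ⟨by linarith [hx.1], hx.2⟩ ⟨by linarith [hy.1], hy.2⟩ hxy
    exact Real.sqrt_lt_sqrt (hbase x hx).le (by gcongr)
  have hle : pstar ≤ pPlus E := by
    rw [← hf0, ← hf1]
    exact (hmono ⟨le_rfl, by positivity⟩ ⟨by positivity, le_rfl⟩ (by positivity)).le
  have himg : f '' Ioo 0 (π / 2) = Ioo pstar (pPlus E) := by
    rw [← hf0, ← hf1]
    refine Subset.antisymm ?_ (intermediate_value_Ioo (by positivity) hcont.continuousOn)
    rintro _ ⟨θ, hθ, rfl⟩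
    exact ⟨hmono ⟨le_rfl, by positivity⟩ (Ioo_subset_Icc_self hθ) hθ.1,
      hmono (Ioo_subset_Icc_self hθ) ⟨by positivity, le_rfl⟩ hθ.2⟩
  have hderiv : ∀ θ ∈ Ioo 0 (π / 2), HasDerivWithinAt f (f' θ) (Ioo 0 (π / 2)) θ := by
    intro θ hθ
    have h := (((Real.hasDerivAt_sin θ).const_mul s).const_add (1 / 2)).sqrt
      (hbase θ (Ioo_subset_Icc_self hθ)).ne'
    exact h.hasDerivWithinAt
  have hinj : InjOn f (Ioo 0 (π / 2)) := hmono.injOn.mono Ioo_subset_Icc_self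
  have hcongr : ∀ θ ∈ Ioo 0 (π / 2), |f' θ| • (1 / √(E + A (f θ))) =
      (1 / 2) * (1 / √(1 / 2 + s * sin θ)) := by
    intro θ hθ
    have hb := hbase θ (Ioo_subset_Icc_self hθ)
    have hcos : 0 < cos θ := Real.cos_pos_of_mem_Ioo ⟨by linarith [hθ.1], hθ.2⟩
    have hr : 0 < √(1 / 2 + s * sin θ) := Real.sqrt_pos.2 hb
    have hval : E + A (f θ) = (s * cos θ) ^ 2 := by
      have : f θ ^ 2 = 1 / 2 + s * sin θ := Real.sq_sqrt hb.le
      rw [A, this, hsE, mul_pow, Real.cos_sq']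
      ring
    rw [hval, Real.sqrt_sq (by positivity), abs_of_pos (by simp only [f']; positivity)]
    simp only [f', smul_eq_mul]
    field_simp
  constructor
  · rw [intervalIntegrable_iff_integrableOn_Ioo_of_le hle, ← himg,
      integrableOn_image_iff_integrableOn_abs_deriv_smul measurableSet_Ioo hderiv hinj,
      integrableOn_congr_fun hcongr measurableSet_Ioo,
      ← intervalIntegrable_iff_integrableOn_Ioo_of_le (by positivity)]
    refine ContinuousOn.intervalIntegrable (continuousOn_const.mul
      (ContinuousOn.div (by fun_prop) (by fun_prop) fun θ hθ => ?_))
    rw [uIcc_of_le (by positivity)] at hθ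
    exact (Real.sqrt_pos.2 (hbase θ hθ)).ne'
  · rw [intervalIntegral.integral_of_le hle, intervalIntegral.integral_of_le (by positivity),
      integral_Ioc_eq_integral_Ioo, integral_Ioc_eq_integral_Ioo, ← himg,
      integral_image_eq_integral_abs_deriv_smul measurableSet_Ioo hderiv hinj]
    exact setIntegral_congr_fun measurableSet_Ioo hcongr

lemma differentiableAt_integral_pstar_pPlus {E : ℝ} (hE : -(1 / 4) < E) :
    DifferentiableAt ℝ (fun E => ∫ u in pstar..pPlus E, 1 / √(E + A u)) E := by
  have hpi := Real.pi_pos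
  have hev : (fun E => ∫ u in pstar..pPlus E, 1 / √(E + A u)) =ᶠ[𝓝 E]
      fun E => (1 / 2) * ∫ θ in (0 : ℝ)..(π / 2), 1 / √(1 / 2 + √(1 + 4 * E) / 2 * sin θ) := by
    filter_upwards [lt_mem_nhds hE] with x hx
    rw [(integral_pstar_pPlus hx).2, intervalIntegral.integral_const_mul]
  refine DifferentiableAt.congr_of_eventuallyEq ?_ hev
  refine DifferentiableAt.const_mul ?_ _
  have h1 := (hasDerivAt_integral_one_div_sqrt_affine (c := fun _ => 1 / 2) (d := sin)
    (a := 0) (b := π / 2) (x₀ := √(1 + 4 * E) / 2) continuous_const Real.continuous_sin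
    (fun θ hθ => by
      rw [uIcc_of_le (by positivity)] at hθ
      have : 0 ≤ sin θ := Real.sin_nonneg_of_nonneg_of_le_pi hθ.1 (by linarith [hθ.2])
      positivity)).differentiableAt
  have h2 : DifferentiableAt ℝ (fun E => √(1 + 4 * E) / 2) E :=
    (DifferentiableAt.sqrt (by fun_prop) (by linarith)).div_const 2
  exact DifferentiableAt.comp E h1 h2

lemma A_le_of_mem_uIcc_pstar {p u : ℝ} (hp : 0 < p) (hu : u ∈ uIcc p pstar) : A p ≤ A u := by
  have hs := pstar_pos
  have hs2 := pstar_sq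
  have hfac : A u - A p = (u ^ 2 - p ^ 2) * (1 - u ^ 2 - p ^ 2) := by unfold A; ring
  have : 0 ≤ A u - A p := by
    rw [hfac]
    rcases le_total p pstar with h | h
    · rw [uIcc_of_le h] at hu
      have h1 : p ^ 2 ≤ u ^ 2 := pow_le_pow_left₀ hp.le hu.1 2
      have h2 : u ^ 2 ≤ pstar ^ 2 := pow_le_pow_left₀ (hp.le.trans hu.1) hu.2 2
      exact mul_nonneg (by linarith) (by linarith)
    · rw [uIcc_of_ge h] at hu
      have h1 : pstar ^ 2 ≤ u ^ 2 := pow_le_pow_left₀ hs.le hu.1 2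
      have h2 : u ^ 2 ≤ p ^ 2 := pow_le_pow_left₀ (hs.le.trans hu.1) hu.2 2
      exact mul_nonneg_of_nonpos_of_nonpos (by linarith) (by linarith)
  linarith

lemma A_le_quarter (u : ℝ) : A u ≤ 1 / 4 := by
  unfold A; nlinarith [sq_nonneg (u ^ 2 - 1 / 2)]

/-- At fixed energy, the base point enters `∂T₊/∂q₀` only through a regular integral. -/
lemma hasDerivAt_Tplus {p q : ℝ} (hp : 0 < p) (hq : 0 < q) :
    HasDerivAt (fun q => Tplus p q)
      (((∫ u in p..pstar, -1 / (2 * √((q ^ 2 - A p) + A u) ^ 3)) +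
        deriv (fun E => ∫ u in pstar..pPlus E, 1 / √(E + A u)) (q ^ 2 - A p)) * (2 * q)) q := by
  have hAp := A_le_quarter p
  have hE0 : -A p < q ^ 2 - A p := by nlinarith [pow_pos hq 2]
  have hreg := hasDerivAt_integral_one_div_sqrt_affine (c := A) (d := fun _ => 1)
    (a := p) (b := pstar) (x₀ := q ^ 2 - A p) continuous_A continuous_const
    (fun u hu => by linarith [A_le_of_mem_uIcc_pstar hp hu])
  simp only [mul_one, add_comm (A _)] at hreg
  have hsum := hreg.add
    (differentiableAt_integral_pstar_pPlus (by linarith : -(1 / 4) < q ^ 2 - A p)).hasDerivAt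
  have henergy : HasDerivAt (fun q => q ^ 2 - A p) (2 * q) q := by
    simpa using (hasDerivAt_pow 2 q).sub_const (A p)
  refine (HasDerivAt.comp q hsum henergy).congr_of_eventuallyEq ?_
  filter_upwards [lt_mem_nhds hq] with r hr
  have hr2 : 0 < r ^ 2 := by positivity
  refine (intervalIntegral.integral_add_adjacent_intervals ?_
    (integral_pstar_pPlus (by linarith)).1).symm
  have := continuous_A
  refine ContinuousOn.intervalIntegrable (ContinuousOn.div (by fun_prop) (by fun_prop) ?_)
  exact fun u hu => (Real.sqrt_pos.2 (by linarith [A_le_of_mem_uIcc_pstar hp hu])).ne'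

/-- there are no two distinct points `(p₁,q₁) ≠ (p₂,q₂)` in `(0,1) × (0,∞)`
with equal energies `q₁² − A(p₁) = q₂² − A(p₂)` that are both critical points of `T₊` in `q₀`. -/
theorem no_two_critical_points_same_energy
    (p₁ q₁ p₂ q₂ : ℝ) (hp₁ : p₁ ∈ Set.Ioo (0 : ℝ) 1) (hq₁ : 0 < q₁)
    (hp₂ : p₂ ∈ Set.Ioo (0 : ℝ) 1) (hq₂ : 0 < q₂)
    (hE : q₁ ^ 2 - A p₁ = q₂ ^ 2 - A p₂)
    (hc₁ : deriv (fun q => Tplus p₁ q) q₁ = 0)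
    (hc₂ : deriv (fun q => Tplus p₂ q) q₂ = 0) :
    (p₁, q₁) = (p₂, q₂) := by
  have hq₁s : 0 < q₁ ^ 2 := by positivity
  have hq₂s : 0 < q₂ ^ 2 := by positivity
  rw [(hasDerivAt_Tplus hp₁.1 hq₁).deriv] at hc₁
  rw [(hasDerivAt_Tplus hp₂.1 hq₂).deriv, ← hE] at hc₂
  have h₁ := (mul_eq_zero.1 hc₁).resolve_right (by positivity)
  have h₂ := (mul_eq_zero.1 hc₂).resolve_right (by positivity)
  set E := q₁ ^ 2 - A p₁
  have hpos₁ : ∀ u ∈ uIcc p₁ pstar, 0 < E + A u := fun u hu => by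
    linarith [A_le_of_mem_uIcc_pstar hp₁.1 hu]
  have hpos₂ : ∀ u ∈ uIcc p₂ pstar, 0 < E + A u := fun u hu => by
    linarith [A_le_of_mem_uIcc_pstar hp₂.1 hu]
  let k : ℝ → ℝ := fun u => -1 / (2 * √(E + A u) ^ 3)
  have hint : ∀ {a b : ℝ}, (∀ u ∈ uIcc a b, 0 < E + A u) → IntervalIntegrable k volume a b := by
    intro a b h
    have := continuous_A
    refine ContinuousOn.intervalIntegrable (ContinuousOn.div (by fun_prop) (by fun_prop) ?_)
    intro u hu
    have := Real.sqrt_pos.2 (h u hu)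
    positivity
  have hpos : ∀ u ∈ uIcc p₁ p₂, 0 < E + A u := fun u hu =>
    (uIcc_subset_uIcc_union_uIcc hu).elim (hpos₁ u) fun h => hpos₂ u (uIcc_comm pstar p₂ ▸ h)
  have hzero : ∫ u in p₁..p₂, k u = 0 := by
    have := intervalIntegral.integral_add_adjacent_intervals (hint hpos) (hint hpos₂)
    linarith
  have hne : ∀ {a b : ℝ}, a < b → (∀ u ∈ uIcc a b, 0 < E + A u) → ∫ u in a..b, k u ≠ 0 := by
    intro a b hab h
    have hneg := intervalIntegral.intervalIntegral_pos_of_pos_on (hint h).neg (fun u hu => by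
      have := Real.sqrt_pos.2 (h u (Ioo_subset_Icc_self.trans Icc_subset_uIcc hu))
      simp only [k, Pi.neg_apply, neg_div, neg_neg]
      positivity) hab
    simp only [Pi.neg_apply, intervalIntegral.integral_neg] at hneg
    linarith
  have hp : p₁ = p₂ := by
    rcases lt_trichotomy p₁ p₂ with h | h | h
    · exact (hne h hpos hzero).elim
    · exact h
    · refine (hne h (uIcc_comm p₁ p₂ ▸ hpos) ?_).elim
      rw [intervalIntegral.integral_symm, hzero, neg_zero]
  subst hp
  have hq : q₁ = q₂ := (pow_left_inj₀ hq₁.le hq₂.le two_ne_zero).1 (by linarith)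
  rw [hq]
end
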